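/- Let T1 ⊆ T2 be quadtrees. If T1 admits an ε-feasible abstract path, then every abstract path in T2 whose cost Ĵ is minimal among all abstract paths in T2 is ε-feasible. -/

import Mathlib

open Finset Filter

/-- The penalty constant `M = 2^{dℓ}(λ₁ + ε λ₂) + γ`. -/
noncomputable def Mval (d ℓ : ℕ) (ε lam1 lam2 γ : ℝ) : ℝ :=
  2 ^ (d * ℓ) * (lam1 + ε * lam2) + γ

/-- The cost `c` on leaves. -/
noncomputable def cst (d ℓ : ℕ) (p : List (Fin (2 ^ d)) → ℝ) (ε lam1 lam2 γ : ℝ)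
    (x : List (Fin (2 ^ d))) : ℝ :=
  if p x ≤ ε then lam1 + lam2 * p x else Mval d ℓ ε lam1 lam2 γ

/-- Auxiliary recursion for `V`, with fuel equal to `ℓ - length`. -/
noncomputable def Vaux (d : ℕ) (c : List (Fin (2 ^ d)) → ℝ) : ℕ → List (Fin (2 ^ d)) → ℝ
  | 0, n => c n
  | k + 1, n => ((2 : ℝ) ^ d)⁻¹ * ∑ i : Fin (2 ^ d), Vaux d c k (n ++ [i])

/-- The function `V`: `V(n) = c(n)` on leaves (length `ℓ`), and
`V(n) = 2^{-d} ∑_{n' child of n} V(n')` on interior nodes. -/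
noncomputable def Vnode (d ℓ : ℕ) (c : List (Fin (2 ^ d)) → ℝ) (n : List (Fin (2 ^ d))) : ℝ :=
  Vaux d c (ℓ - n.length) n

/-- A quadtree: a set of nodes (lists of length ≤ ℓ) containing the root, closed under
parents, and sibling-complete. -/
def IsQuadtree (d ℓ : ℕ) (T : Set (List (Fin (2 ^ d)))) : Prop :=
  [] ∈ T ∧ (∀ n ∈ T, n.length ≤ ℓ) ∧ (∀ n ∈ T, n ≠ [] → n.dropLast ∈ T) ∧
    ∀ (n : List (Fin (2 ^ d))) (i j : Fin (2 ^ d)), n ++ [i] ∈ T → n ++ [j] ∈ T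

/-- A leaf of a quadtree `T`: an element of `T` none of whose children lies in `T`. -/
def IsLeafOf (d : ℕ) (T : Set (List (Fin (2 ^ d)))) (n : List (Fin (2 ^ d))) : Prop :=
  n ∈ T ∧ ∀ i : Fin (2 ^ d), n ++ [i] ∉ T

/-- The `i`-th coordinate of the center of the hypercube represented by node `n`. -/
noncomputable def center (d ℓ : ℕ) (n : List (Fin (2 ^ d))) (i : Fin d) : ℝ :=
  (∑ j : Fin n.length,
      ((((n.get j).val / 2 ^ (i : ℕ)) % 2 : ℕ) : ℝ) * (2 : ℝ) ^ ((ℓ : ℤ) - (j : ℕ) - 1)) +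
    (2 : ℝ) ^ ((ℓ : ℤ) - (n.length : ℕ) - 1)

/-- Nodal neighbors: the sup-distance of the centers equals `2^{r(n)-1} + 2^{r(m)-1}`
and exactly one coordinate realizes this value. -/
def NodalNeighbors (d ℓ : ℕ) (n m : List (Fin (2 ^ d))) : Prop :=
  (∀ i : Fin d, |center d ℓ n i - center d ℓ m i| ≤
      (2 : ℝ) ^ ((ℓ : ℤ) - (n.length : ℕ) - 1) + (2 : ℝ) ^ ((ℓ : ℤ) - (m.length : ℕ) - 1)) ∧
    ∃! i : Fin d, |center d ℓ n i - center d ℓ m i| =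
      (2 : ℝ) ^ ((ℓ : ℤ) - (n.length : ℕ) - 1) + (2 : ℝ) ^ ((ℓ : ℤ) - (m.length : ℕ) - 1)

/-- An abstract path in the quadtree `T` from start leaf `s0` to goal leaf `sg`. -/
structure AbstractPath (d ℓ : ℕ) (T : Set (List (Fin (2 ^ d)))) (s0 sg : List (Fin (2 ^ d))) where
  R : ℕ
  z : Fin (R + 1) → List (Fin (2 ^ d))
  inj : Function.Injective z
  leaf : ∀ i, IsLeafOf d T (z i)
  start : z 0 <+: s0
  goal : z (Fin.last R) <+: sg
  neigh : ∀ i : Fin R, NodalNeighbors d ℓ (z i.castSucc) (z i.succ)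

/-- The cost `Ĵ` of an abstract path. -/
noncomputable def pathCost (d ℓ : ℕ) (c : List (Fin (2 ^ d)) → ℝ) {T : Set (List (Fin (2 ^ d)))}
    {s0 sg : List (Fin (2 ^ d))} (pth : AbstractPath d ℓ T s0 sg) : ℝ :=
  ∑ i, (2 : ℝ) ^ (d * (ℓ - (pth.z i).length)) * Vnode d ℓ c (pth.z i)

/-- An abstract path is ε-feasible if every leaf descendant of every node of the path
has occupancy probability at most ε. -/
def EpsFeasible (d ℓ : ℕ) (p : List (Fin (2 ^ d)) → ℝ) (ε : ℝ) {T : Set (List (Fin (2 ^ d)))}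
    {s0 sg : List (Fin (2 ^ d))} (pth : AbstractPath d ℓ T s0 sg) : Prop :=
  ∀ i, ∀ x : List (Fin (2 ^ d)), pth.z i <+: x → x.length = ℓ → p x ≤ ε

/-- The integer position of the cell `n` along axis `i`, in units of the side length of `n`. -/
def coord {d : ℕ} (n : List (Fin (2 ^ d))) (i : Fin d) : ℕ :=
  n.foldl (fun a c => 2 * a + c.val / 2 ^ (i : ℕ) % 2) 0

theorem coord_append_singleton {d : ℕ} (n : List (Fin (2 ^ d))) (c : Fin (2 ^ d)) (i : Fin d) :
    coord (n ++ [c]) i = 2 * coord n i + c.val / 2 ^ (i : ℕ) % 2 := by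
  simp [coord]

theorem exists_fin_of_bits {d : ℕ} (b : Fin d → ℕ) (hb : ∀ i, b i < 2) :
    ∃ c : Fin (2 ^ d), ∀ i : Fin d, c.val / 2 ^ (i : ℕ) % 2 = b i := by
  refine ⟨finFunctionFinEquiv fun i => ⟨b i, hb i⟩, fun i => ?_⟩
  have h := congrArg Fin.val (congrFun (finFunctionFinEquiv.symm_apply_apply
    (fun i => (⟨b i, hb i⟩ : Fin 2))) i)
  rwa [finFunctionFinEquiv_symm_apply_val] at h

theorem fin_ext_of_bits {d : ℕ} {c e : Fin (2 ^ d)}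
    (h : ∀ i : Fin d, c.val / 2 ^ (i : ℕ) % 2 = e.val / 2 ^ (i : ℕ) % 2) : c = e := by
  apply (finFunctionFinEquiv (m := 2) (n := d)).symm.injective
  funext i
  exact Fin.ext (by simpa using h i)

theorem list_eq_of_coord_eq {d : ℕ} (n : List (Fin (2 ^ d))) :
    ∀ m : List (Fin (2 ^ d)), n.length = m.length → (∀ i, coord n i = coord m i) → n = m := by
  induction n using List.reverseRecOn with
  | nil => intro m hm _; exact (List.eq_nil_of_length_eq_zero hm.symm).symm
  | append_singleton n c ih =>
    intro m hm hc
    rcases List.eq_nil_or_concat m with rfl | ⟨m, e, rfl⟩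
    · simp at hm
    · rw [List.concat_eq_append] at *
      simp only [coord_append_singleton] at hc
      have h1 : n = m := ih m (by simpa using hm) fun i => by have := hc i; omega
      have h2 : c = e := fin_ext_of_bits fun i => by have := hc i; omega
      rw [h1, h2]

/-- The unit cell with integer position `v` lies in the hypercube of the node `n`. -/
def InBox {d : ℕ} (ℓ : ℕ) (n : List (Fin (2 ^ d))) (v : Fin d → ℕ) : Prop :=
  ∀ i, coord n i * 2 ^ (ℓ - n.length) ≤ v i ∧ v i < (coord n i + 1) * 2 ^ (ℓ - n.length)

theorem InBox.of_append_singleton {d ℓ : ℕ} {n : List (Fin (2 ^ d))} {c : Fin (2 ^ d)}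
    {v : Fin d → ℕ} (hn : n.length < ℓ) (h : InBox ℓ (n ++ [c]) v) : InBox ℓ n v := by
  intro i
  have hi := h i
  have e : ℓ - n.length = (ℓ - (n ++ [c]).length) + 1 := by simp; omega
  rw [coord_append_singleton] at hi
  rw [e, pow_succ]
  generalize 2 ^ (ℓ - (n ++ [c]).length) = w at *
  have : c.val / 2 ^ (i : ℕ) % 2 < 2 := Nat.mod_lt _ (by norm_num)
  generalize c.val / 2 ^ (i : ℕ) % 2 = b at *
  constructor <;> nlinarith

theorem InBox.of_prefix {d ℓ : ℕ} {n m : List (Fin (2 ^ d))} {v : Fin d → ℕ}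
    (hm : m.length ≤ ℓ) (hnm : n <+: m) (h : InBox ℓ m v) : InBox ℓ n v := by
  obtain ⟨t, rfl⟩ := hnm
  induction t using List.reverseRecOn with
  | nil => simpa using h
  | append_singleton t c ih =>
    rw [← List.append_assoc] at h hm
    rw [List.length_append, List.length_singleton] at hm
    exact ih (by omega) (h.of_append_singleton (by omega))

theorem InBox.exists_child {d ℓ : ℕ} {n : List (Fin (2 ^ d))} {v : Fin d → ℕ}
    (hn : n.length < ℓ) (h : InBox ℓ n v) : ∃ c, InBox ℓ (n ++ [c]) v := by
  have e : ℓ - n.length = (ℓ - (n.length + 1)) + 1 := by omega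
  have hw : 0 < 2 ^ (ℓ - (n.length + 1)) := by positivity
  obtain ⟨c, hc⟩ := exists_fin_of_bits
    (fun i => if (2 * coord n i + 1) * 2 ^ (ℓ - (n.length + 1)) ≤ v i then 1 else 0)
    (fun i => by split_ifs <;> norm_num)
  refine ⟨c, fun i => ?_⟩
  have hi := h i
  rw [coord_append_singleton, hc i, List.length_append, List.length_singleton]
  rw [e, pow_succ] at hi
  generalize 2 ^ (ℓ - (n.length + 1)) = w at *
  split_ifs <;> constructor <;> nlinarith

theorem InBox.isPrefix {d ℓ : ℕ} {n m : List (Fin (2 ^ d))} {v : Fin d → ℕ}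
    (hm : m.length ≤ ℓ) (hnm : n.length ≤ m.length) (h : InBox ℓ n v) (h' : InBox ℓ m v) :
    n <+: m := by
  have h'' := h'.of_prefix hm (List.take_prefix n.length m)
  have hl : (m.take n.length).length = n.length := by simpa using hnm
  have : n = m.take n.length := by
    refine list_eq_of_coord_eq _ _ hl.symm fun i => ?_
    have h1 := h i
    have h2 := h'' i
    rw [hl] at h2
    have hw : 0 < 2 ^ (ℓ - n.length) := by positivity
    have h3 := lt_of_mul_lt_mul_right (h1.1.trans_lt h2.2) hw.le
    have h4 := lt_of_mul_lt_mul_right (h2.1.trans_lt h1.2) hw.le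
    omega
  rw [this]
  exact List.take_prefix _ _

theorem inBox_coord {d ℓ : ℕ} {x : List (Fin (2 ^ d))} (hx : x.length = ℓ) :
    InBox ℓ x (coord x) := by
  intro i
  simp [hx]

theorem IsLeafOf.eq_of_prefix {d ℓ : ℕ} {T : Set (List (Fin (2 ^ d)))} (hT : IsQuadtree d ℓ T)
    {n m : List (Fin (2 ^ d))} (hn : IsLeafOf d T n) (hm : m ∈ T) (h : n <+: m) : n = m := by
  obtain ⟨t, rfl⟩ := h
  induction t using List.reverseRecOn with
  | nil => simp
  | append_singleton t c ih =>
    rw [← List.append_assoc] at hm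
    have h1 := hT.2.2.1 _ hm (by simp)
    rw [List.dropLast_concat] at h1
    have h2 := ih h1
    rw [← h2] at hm
    exact absurd hm (hn.2 c)

theorem IsLeafOf.eq_of_inBox {d ℓ : ℕ} {T : Set (List (Fin (2 ^ d)))} (hT : IsQuadtree d ℓ T)
    {n m : List (Fin (2 ^ d))} (hn : IsLeafOf d T n) (hm : IsLeafOf d T m) {v : Fin d → ℕ}
    (h : InBox ℓ n v) (h' : InBox ℓ m v) : n = m := by
  rcases le_total n.length m.length with hl | hl
  · exact hn.eq_of_prefix hT hm.1 (h.isPrefix (hT.2.1 _ hm.1) hl h')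
  · exact (hm.eq_of_prefix hT hn.1 (h'.isPrefix (hT.2.1 _ hn.1) hl h)).symm

theorem IsQuadtree.exists_leaf {d ℓ : ℕ} {T : Set (List (Fin (2 ^ d)))} (hT : IsQuadtree d ℓ T)
    {v : Fin d → ℕ} (k : ℕ) : ∀ n ∈ T, InBox ℓ n v → ℓ - n.length = k →
      ∃ m, IsLeafOf d T m ∧ n <+: m ∧ InBox ℓ m v := by
  induction k with
  | zero =>
    intro n hn hv hk
    refine ⟨n, ⟨hn, fun i hi => ?_⟩, List.prefix_rfl, hv⟩
    have := hT.2.1 _ hi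
    simp at this
    omega
  | succ k ih =>
    intro n hn hv hk
    by_cases hl : IsLeafOf d T n
    · exact ⟨n, hl, List.prefix_rfl, hv⟩
    · obtain ⟨j, hj⟩ : ∃ j, n ++ [j] ∈ T := by
        by_contra hc
        exact hl ⟨hn, fun i hi => hc ⟨i, hi⟩⟩
      obtain ⟨c, hc⟩ := hv.exists_child (by omega)
      obtain ⟨m, hm, hp, hb⟩ := ih (n ++ [c]) (hT.2.2.2 n j c hj) hc (by simp; omega)
      exact ⟨m, hm, (List.prefix_append n [c]).trans hp, hb⟩

theorem foldl_mul_zpow {α : Type*} (f : α → ℕ) (n : List α) : ∀ (a : ℕ) (k : ℤ),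
    ((n.foldl (fun a c => 2 * a + f c) a : ℕ) : ℝ) * (2 : ℝ) ^ (k - (n.length : ℕ)) =
      a * (2 : ℝ) ^ k + ∑ j : Fin n.length, (f (n.get j) : ℝ) * (2 : ℝ) ^ (k - (j : ℕ) - 1) := by
  induction n with
  | nil => intro a k; simp
  | cons c t ih =>
    intro a k
    have h := ih (2 * a + f c) (k - 1)
    have e : k - ((c :: t).length : ℕ) = k - 1 - (t.length : ℕ) := by
      rw [List.length_cons]; push_cast; ring
    rw [List.foldl_cons, e, h]
    have hs : ∑ j : Fin (c :: t).length, (f ((c :: t).get j) : ℝ) * (2 : ℝ) ^ (k - (j : ℕ) - 1) =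
        (f c : ℝ) * (2 : ℝ) ^ (k - 1) +
          ∑ j : Fin t.length, (f (t.get j) : ℝ) * (2 : ℝ) ^ (k - 1 - (j : ℕ) - 1) := by
      refine (Fin.sum_univ_succ (n := t.length) _).trans ?_
      congr 1
      · simp
      · refine Finset.sum_congr rfl fun j _ => ?_
        simp only [List.get_cons_succ', Fin.val_succ]
        congr 2
        push_cast; ring
    rw [hs]
    have : (2 : ℝ) ^ k = 2 * (2 : ℝ) ^ (k - 1) := by
      rw [← zpow_one_add₀ (by norm_num)]; congr 1; ring
    rw [this]; push_cast; ring

theorem zpow_half_side {ℓ k : ℕ} (hk : k ≤ ℓ) :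
    (2 : ℝ) ^ ((ℓ : ℤ) - (k : ℕ) - 1) = ((2 ^ (ℓ - k) : ℕ) : ℝ) / 2 := by
  rw [zpow_sub_one₀ (by norm_num), ← Nat.cast_sub hk, zpow_natCast]
  push_cast; ring

theorem center_eq {d ℓ : ℕ} {n : List (Fin (2 ^ d))} (hn : n.length ≤ ℓ) (i : Fin d) :
    center d ℓ n i = ((coord n i * 2 ^ (ℓ - n.length) : ℕ) : ℝ) +
      ((2 ^ (ℓ - n.length) : ℕ) : ℝ) / 2 := by
  have h := foldl_mul_zpow (fun c : Fin (2 ^ d) => c.val / 2 ^ (i : ℕ) % 2) n 0 ℓ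
  rw [Nat.cast_zero, zero_mul, zero_add, ← Nat.cast_sub hn, zpow_natCast] at h
  rw [center, zpow_half_side hn, ← h, coord]
  push_cast; ring

theorem NodalNeighbors.exists_adjacent_cells {d ℓ : ℕ} {n m : List (Fin (2 ^ d))}
    (hn : n.length ≤ ℓ) (hm : m.length ≤ ℓ) (h : NodalNeighbors d ℓ n m) :
    ∃ u v : Fin d → ℕ, InBox ℓ n u ∧ InBox ℓ m v ∧ ∃ i, (u i + 1 = v i ∨ v i + 1 = u i) ∧
      ∀ j, j ≠ i → u j = v j := by
  obtain ⟨hle, i, hi, hu⟩ := h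
  simp only [center_eq hn, center_eq hm, zpow_half_side hn, zpow_half_side hm] at hle hi hu
  have key : ∀ j, ∃ a b : ℕ, (coord n j * 2 ^ (ℓ - n.length) ≤ a ∧
      a < (coord n j + 1) * 2 ^ (ℓ - n.length)) ∧ (coord m j * 2 ^ (ℓ - m.length) ≤ b ∧
      b < (coord m j + 1) * 2 ^ (ℓ - m.length)) ∧ (j = i → (a + 1 = b ∨ b + 1 = a)) ∧
      (j ≠ i → a = b) := by
    intro j
    have hw : 0 < 2 ^ (ℓ - n.length) := by positivity
    have hw' : 0 < 2 ^ (ℓ - m.length) := by positivity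
    have hlej := hle j
    have huj := hu j
    by_cases hj : j = i
    · subst hj
      rw [add_one_mul, add_one_mul]
      clear hle hu hlej huj
      generalize coord n j * 2 ^ (ℓ - n.length) = A at *
      generalize coord m j * 2 ^ (ℓ - m.length) = B at *
      generalize 2 ^ (ℓ - n.length) = w at *
      generalize 2 ^ (ℓ - m.length) = w' at *
      rcases abs_cases ((A : ℝ) + w / 2 - (B + w' / 2)) with ⟨h1, -⟩ | ⟨h1, -⟩
      · have h2 : A = B + w' := by
          have : (A : ℝ) = B + w' := by linarith
          exact_mod_cast this
        exact ⟨A, A - 1, by omega, by omega, by omega, by simp⟩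
      · have h2 : B = A + w := by
          have : (B : ℝ) = A + w := by linarith
          exact_mod_cast this
        exact ⟨B - 1, B, by omega, by omega, by omega, by simp⟩
    · have hlt := lt_of_le_of_ne hlej fun h => hj (huj h)
      rw [add_one_mul, add_one_mul]
      clear hle hu hlej huj hi
      generalize coord n j * 2 ^ (ℓ - n.length) = A at *
      generalize coord m j * 2 ^ (ℓ - m.length) = B at *
      generalize 2 ^ (ℓ - n.length) = w at *
      generalize 2 ^ (ℓ - m.length) = w' at *
      rw [abs_lt] at hlt
      have h1 : A < B + w' := by
        have : (A : ℝ) < B + w' := by linarith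
        exact_mod_cast this
      have h2 : B < A + w := by
        have : (B : ℝ) < A + w := by linarith
        exact_mod_cast this
      exact ⟨max A B, max A B, by omega, by omega, fun h => absurd h hj, fun _ => rfl⟩
  choose u v h1 h2 h3 h4 using key
  exact ⟨u, v, h1, h2, i, h3 i rfl, h4⟩

theorem NodalNeighbors.symm {d ℓ : ℕ} {n m : List (Fin (2 ^ d))} (h : NodalNeighbors d ℓ n m) :
    NodalNeighbors d ℓ m n := by
  unfold NodalNeighbors at *
  simp only [abs_sub_comm (center d ℓ m _), add_comm ((2 : ℝ) ^ ((ℓ : ℤ) - (m.length : ℕ) - 1))]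
  exact h

theorem nodalNeighbors_of_adjacent_cells {d ℓ : ℕ} {T : Set (List (Fin (2 ^ d)))}
    (hT : IsQuadtree d ℓ T) {n m : List (Fin (2 ^ d))} (hn : IsLeafOf d T n) (hm : IsLeafOf d T m)
    (hne : n ≠ m) {u v : Fin d → ℕ} (hu : InBox ℓ n u) (hv : InBox ℓ m v) {i : Fin d}
    (hi : u i + 1 = v i) (hj : ∀ j, j ≠ i → u j = v j) : NodalNeighbors d ℓ n m := by
  have hnl := hT.2.1 _ hn.1
  have hml := hT.2.1 _ hm.1
  have hv' : ¬ InBox ℓ n v := fun h => hne (hn.eq_of_inBox hT hm h hv)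
  have hu' : ¬ InBox ℓ m u := fun h => hne (hn.eq_of_inBox hT hm hu h)
  have e1 : v i = (coord n i + 1) * 2 ^ (ℓ - n.length) := by
    by_contra hc
    refine hv' fun j => ?_
    by_cases hji : j = i
    · subst hji; have := hu j; omega
    · rw [← hj j hji]; exact hu j
  have e2 : v i = coord m i * 2 ^ (ℓ - m.length) := by
    by_contra hc
    refine hu' fun j => ?_
    by_cases hji : j = i
    · subst hji; have := hv j; omega
    · rw [hj j hji]; exact hv j
  have heq : |center d ℓ n i - center d ℓ m i| =
      (2 : ℝ) ^ ((ℓ : ℤ) - (n.length : ℕ) - 1) + (2 : ℝ) ^ ((ℓ : ℤ) - (m.length : ℕ) - 1) := by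
    rw [center_eq hnl, center_eq hml, zpow_half_side hnl, zpow_half_side hml, ← e2, e1,
      add_one_mul]
    push_cast
    rw [abs_sub_comm, abs_of_nonneg] <;> ring_nf
    positivity
  have hlt : ∀ j, j ≠ i → |center d ℓ n j - center d ℓ m j| <
      (2 : ℝ) ^ ((ℓ : ℤ) - (n.length : ℕ) - 1) + (2 : ℝ) ^ ((ℓ : ℤ) - (m.length : ℕ) - 1) := by
    intro j hji
    have h1 := hu j
    have h2 := hv j
    rw [← hj j hji] at h2
    have h3 := h1.1.trans_lt h2.2
    have h4 := h2.1.trans_lt h1.2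
    rw [add_one_mul, ← Nat.cast_lt (α := ℝ), Nat.cast_add] at h3 h4
    rw [center_eq hnl, center_eq hml, zpow_half_side hnl, zpow_half_side hml, abs_lt]
    constructor <;> linarith
  refine ⟨fun j => ?_, i, heq, fun j hje => ?_⟩
  · by_cases hji : j = i
    · rw [hji, heq]
    · exact (hlt j hji).le
  · by_contra hji
    exact (hlt j hji).ne hje

/-- The nodal-neighbor graph on the leaves of `T` satisfying `P`. -/
def leafGraph (d ℓ : ℕ) (T : Set (List (Fin (2 ^ d)))) (P : List (Fin (2 ^ d)) → Prop) :
    SimpleGraph {n // IsLeafOf d T n ∧ P n} where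
  Adj n m := n ≠ m ∧ NodalNeighbors d ℓ n.1 m.1
  symm := ⟨fun _ _ h => ⟨h.1.symm, h.2.symm⟩⟩
  loopless := ⟨fun _ h => h.1 rfl⟩

theorem leafGraph_reachable_of_adjacent_cells {d ℓ : ℕ} {T : Set (List (Fin (2 ^ d)))}
    (hT : IsQuadtree d ℓ T) {P : List (Fin (2 ^ d)) → Prop} (n m : {n // IsLeafOf d T n ∧ P n})
    {u v : Fin d → ℕ} (hu : InBox ℓ n.1 u) (hv : InBox ℓ m.1 v) {i : Fin d}
    (hi : u i + 1 = v i ∨ v i + 1 = u i) (hj : ∀ j, j ≠ i → u j = v j) :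
    (leafGraph d ℓ T P).Reachable n m := by
  by_cases hne : n = m
  · rw [hne]
  have hne' : n.1 ≠ m.1 := fun h => hne (Subtype.ext h)
  refine SimpleGraph.Adj.reachable ⟨hne, ?_⟩
  rcases hi with hi | hi
  · exact nodalNeighbors_of_adjacent_cells hT n.2.1 m.2.1 hne' hu hv hi hj
  · exact (nodalNeighbors_of_adjacent_cells hT m.2.1 n.2.1 hne'.symm hv hu hi
      fun j h => (hj j h).symm).symm

theorem leafGraph_reachable_in_box {d ℓ : ℕ} {T : Set (List (Fin (2 ^ d)))}
    (hT : IsQuadtree d ℓ T) {P : List (Fin (2 ^ d)) → Prop} {z : List (Fin (2 ^ d))} (hz : z ∈ T)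
    (hP : ∀ n, z <+: n → P n) (k : ℕ) :
    ∀ (u v : Fin d → ℕ) (n m : {n // IsLeafOf d T n ∧ P n}), InBox ℓ z u → InBox ℓ z v →
      InBox ℓ n.1 u → InBox ℓ m.1 v → ∑ i, Nat.dist (u i) (v i) = k →
      (leafGraph d ℓ T P).Reachable n m := by
  induction k with
  | zero =>
    intro u v n m _ _ hu hv hk
    have huv : u = v := by
      funext i
      exact Nat.eq_of_dist_eq_zero (Finset.sum_eq_zero_iff.1 hk i (Finset.mem_univ i))
    subst huv
    rw [Subtype.ext (n.2.1.eq_of_inBox hT m.2.1 hu hv)]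
  | succ k ih =>
    intro u v n m hzu hzv hu hv hk
    obtain ⟨i, -, hi⟩ : ∃ i ∈ Finset.univ, Nat.dist (u i) (v i) ≠ 0 :=
      Finset.exists_ne_zero_of_sum_ne_zero (by rw [hk]; omega)
    obtain ⟨a, ha, had, hab⟩ : ∃ a, (u i + 1 = a ∨ a + 1 = u i) ∧
        Nat.dist a (v i) + 1 = Nat.dist (u i) (v i) ∧ min (u i) (v i) ≤ a ∧ a ≤ max (u i) (v i) := by
      unfold Nat.dist at *
      rcases lt_trichotomy (u i) (v i) with h | h | h
      · exact ⟨u i + 1, by omega⟩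
      · omega
      · exact ⟨u i - 1, by omega⟩
    have hzu' : InBox ℓ z (Function.update u i a) := by
      intro j
      by_cases hj : j = i
      · subst hj
        have h1 := hzu j
        have h2 := hzv j
        rw [Function.update_self]
        omega
      · rw [Function.update_of_ne hj]; exact hzu j
    obtain ⟨q, hq, hzq, hqu⟩ := hT.exists_leaf _ z hz hzu' rfl
    refine (leafGraph_reachable_of_adjacent_cells hT n ⟨q, hq, hP q hzq⟩ hu hqu (i := i)
      (by simpa using ha) fun j hj => by simp [hj]).trans
      (ih _ v ⟨q, hq, hP q hzq⟩ m hzu' hzv hqu hv ?_)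
    rw [← Finset.add_sum_erase _ _ (Finset.mem_univ i)] at hk ⊢
    rw [Function.update_self, Finset.sum_congr rfl fun j hj => by
      rw [Function.update_of_ne (Finset.ne_of_mem_erase hj)]]
    omega

theorem exists_abstractPath_of_reachable {d ℓ : ℕ} {T : Set (List (Fin (2 ^ d)))}
    {P : List (Fin (2 ^ d)) → Prop} {s0 sg : List (Fin (2 ^ d))}
    {n m : {n // IsLeafOf d T n ∧ P n}} (hn : n.1 <+: s0) (hm : m.1 <+: sg)
    (h : (leafGraph d ℓ T P).Reachable n m) :
    ∃ q : AbstractPath d ℓ T s0 sg, ∀ i, P (q.z i) := by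
  obtain ⟨w, hw⟩ := h.exists_isPath
  refine ⟨⟨w.length, fun i => (w.getVert i).1, fun i j hij => ?_, fun i => (w.getVert i).2.1,
    by simpa using hn, by simpa using hm, fun i => ?_⟩, fun i => (w.getVert i).2.2⟩
  · exact Fin.ext (hw.getVert_injOn (Nat.le_of_lt_succ i.2) (Nat.le_of_lt_succ j.2)
      (Subtype.ext hij))
  · exact (w.adj_getVert_succ i.2).2

theorem exists_refined_abstractPath {d ℓ : ℕ} {T1 T2 : Set (List (Fin (2 ^ d)))}
    (hT1 : IsQuadtree d ℓ T1) (hT2 : IsQuadtree d ℓ T2) (hsub : T1 ⊆ T2)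
    {s0 sg : List (Fin (2 ^ d))} (hs0 : s0.length = ℓ) (hsg : sg.length = ℓ)
    (π : AbstractPath d ℓ T1 s0 sg) :
    ∃ q : AbstractPath d ℓ T2 s0 sg, ∀ i, ∃ j, π.z j <+: q.z i := by
  have hz : ∀ i, π.z i ∈ T2 := fun i => hsub (π.leaf i).1
  have hlen : ∀ i, (π.z i).length ≤ ℓ := fun i => hT1.2.1 _ (π.leaf i).1
  have hb0 := (inBox_coord hs0).of_prefix hs0.le π.start
  have hbg := (inBox_coord hsg).of_prefix hsg.le π.goal
  obtain ⟨n0, hn0, hp0, hc0⟩ := hT2.exists_leaf _ _ (hz _) hb0 rfl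
  obtain ⟨ng, hng, hpg, hcg⟩ := hT2.exists_leaf _ _ (hz _) hbg rfl
  let P : List (Fin (2 ^ d)) → Prop := fun n => ∃ j, π.z j <+: n
  have hP : ∀ i n, π.z i <+: n → P n := fun i n h => ⟨i, h⟩
  have key : ∀ (i : Fin (π.R + 1)) (m : {n // IsLeafOf d T2 n ∧ P n}) (v : Fin d → ℕ),
      InBox ℓ (π.z i) v → InBox ℓ m.1 v →
      (leafGraph d ℓ T2 P).Reachable ⟨n0, hn0, hP 0 n0 hp0⟩ m := by
    intro i
    induction i using Fin.induction with
    | zero =>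
      intro m v hzv hv
      exact leafGraph_reachable_in_box hT2 (hz 0) (hP 0) _ _ v _ m hb0 hzv hc0 hv rfl
    | succ i ih =>
      intro m v hzv hv
      obtain ⟨a, b, ha, hb, j, hj, hj'⟩ :=
        (π.neigh i).exists_adjacent_cells (hlen _) (hlen _)
      obtain ⟨x, hx, hpx, hcx⟩ := hT2.exists_leaf _ _ (hz _) ha rfl
      obtain ⟨y, hy, hpy, hcy⟩ := hT2.exists_leaf _ _ (hz _) hb rfl
      exact ((ih ⟨x, hx, hP _ x hpx⟩ a ha hcx).trans
        (leafGraph_reachable_of_adjacent_cells hT2 _ ⟨y, hy, hP _ y hpy⟩ hcx hcy hj hj')).trans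
        (leafGraph_reachable_in_box hT2 (hz i.succ) (hP i.succ) _ b v _ m hb hzv hcy hv rfl)
  refine exists_abstractPath_of_reachable (P := P) ?_ ?_
    (key (Fin.last _) ⟨ng, hng, hP _ ng hpg⟩ _ hbg hcg)
  · exact hc0.isPrefix hs0.le (by rw [hs0]; exact hT2.2.1 _ hn0.1) (inBox_coord hs0)
  · exact hcg.isPrefix hsg.le (by rw [hsg]; exact hT2.2.1 _ hng.1) (inBox_coord hsg)

/-- The set of unit cells contained in the hypercube of `n`. -/
def boxCells {d : ℕ} (ℓ : ℕ) (n : List (Fin (2 ^ d))) : Finset (Fin d → ℕ) :=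
  Fintype.piFinset fun i =>
    Finset.Ico (coord n i * 2 ^ (ℓ - n.length)) ((coord n i + 1) * 2 ^ (ℓ - n.length))

theorem mem_boxCells {d ℓ : ℕ} {n : List (Fin (2 ^ d))} {v : Fin d → ℕ} :
    v ∈ boxCells ℓ n ↔ InBox ℓ n v := by
  simp [boxCells, InBox]

theorem card_boxCells {d : ℕ} (ℓ : ℕ) (n : List (Fin (2 ^ d))) :
    (boxCells ℓ n).card = 2 ^ (d * (ℓ - n.length)) := by
  simp [boxCells, add_one_mul, pow_mul']

theorem AbstractPath.sum_volume_le {d ℓ : ℕ} {T : Set (List (Fin (2 ^ d)))}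
    (hT : IsQuadtree d ℓ T) {s0 sg : List (Fin (2 ^ d))} (q : AbstractPath d ℓ T s0 sg) :
    ∑ i, 2 ^ (d * (ℓ - (q.z i).length)) ≤ 2 ^ (d * ℓ) := by
  have hd : (↑(Finset.univ : Finset (Fin (q.R + 1))) : Set (Fin (q.R + 1))).PairwiseDisjoint
      fun i => boxCells ℓ (q.z i) := by
    intro i _ j _ hij
    refine Finset.disjoint_left.2 fun v hi hj => hij (q.inj ?_)
    exact (q.leaf i).eq_of_inBox hT (q.leaf j) (mem_boxCells.1 hi) (mem_boxCells.1 hj)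
  have hs : (Finset.univ.biUnion fun i => boxCells ℓ (q.z i)) ⊆ boxCells (d := d) ℓ [] := by
    intro v hv
    obtain ⟨i, -, hi⟩ := Finset.mem_biUnion.1 hv
    exact mem_boxCells.2 ((mem_boxCells.1 hi).of_prefix (hT.2.1 _ (q.leaf i).1) List.nil_prefix)
  have h := Finset.card_le_card hs
  rw [Finset.card_biUnion hd] at h
  simpa [card_boxCells] using h

theorem Vaux_le {d ℓ : ℕ} {c : List (Fin (2 ^ d)) → ℝ} {B : ℝ} (k : ℕ) :
    ∀ n : List (Fin (2 ^ d)), n.length + k = ℓ →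
      (∀ x, n <+: x → x.length = ℓ → c x ≤ B) → Vaux d c k n ≤ B := by
  induction k with
  | zero => intro n hn h; exact h n List.prefix_rfl (by simpa using hn)
  | succ k ih =>
    intro n hn h
    have h1 : ∑ i : Fin (2 ^ d), Vaux d c k (n ++ [i]) ≤ ∑ _i : Fin (2 ^ d), B :=
      Finset.sum_le_sum fun i _ => ih _ (by simp; omega) fun x hx =>
        h x ((List.prefix_append n [i]).trans hx)
    rw [Vaux, inv_mul_le_iff₀ (by positivity)]
    simpa using h1

theorem Vaux_nonneg {d ℓ : ℕ} {c : List (Fin (2 ^ d)) → ℝ}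
    (hc : ∀ x, x.length = ℓ → 0 ≤ c x) (k : ℕ) :
    ∀ n : List (Fin (2 ^ d)), n.length + k = ℓ → 0 ≤ Vaux d c k n := by
  induction k with
  | zero => intro n hn; exact hc n (by simpa using hn)
  | succ k ih =>
    intro n hn
    exact mul_nonneg (by positivity) (Finset.sum_nonneg fun i _ => ih _ (by simp; omega))

theorem le_pow_mul_Vaux {d ℓ : ℕ} {c : List (Fin (2 ^ d)) → ℝ}
    (hc : ∀ x, x.length = ℓ → 0 ≤ c x) {x : List (Fin (2 ^ d))} (hx : x.length = ℓ) (k : ℕ) :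
    ∀ n : List (Fin (2 ^ d)), n.length + k = ℓ → n <+: x → c x ≤ 2 ^ (d * k) * Vaux d c k n := by
  induction k with
  | zero =>
    intro n hn h
    have : n = x := h.eq_of_length (by omega)
    simp [Vaux, this]
  | succ k ih =>
    intro n hn h
    obtain ⟨t, rfl⟩ := h
    obtain _ | ⟨a, t⟩ := t
    · simp at hx; omega
    have h1 := ih (n ++ [a]) (by simp; omega) ⟨t, by simp⟩
    have h2 : Vaux d c k (n ++ [a]) ≤ ∑ i : Fin (2 ^ d), Vaux d c k (n ++ [i]) :=
      Finset.single_le_sum (f := fun i => Vaux d c k (n ++ [i]))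
        (fun i _ => Vaux_nonneg hc k _ (by simp; omega)) (Finset.mem_univ a)
    have e : (2 : ℝ) ^ (d * (k + 1)) * Vaux d c (k + 1) n =
        2 ^ (d * k) * ∑ i : Fin (2 ^ d), Vaux d c k (n ++ [i]) := by
      rw [Vaux, mul_add, mul_one, pow_add]
      field_simp
    rw [e]
    exact h1.trans (by gcongr)

theorem pathCost_le_of_bound {d ℓ : ℕ} {T : Set (List (Fin (2 ^ d)))} (hT : IsQuadtree d ℓ T)
    {s0 sg : List (Fin (2 ^ d))} (q : AbstractPath d ℓ T s0 sg) {c : List (Fin (2 ^ d)) → ℝ}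
    {B : ℝ} (hB : 0 ≤ B) (h : ∀ i x, q.z i <+: x → x.length = ℓ → c x ≤ B) :
    pathCost d ℓ c q ≤ 2 ^ (d * ℓ) * B := by
  have h1 : pathCost d ℓ c q ≤ ∑ i, (2 : ℝ) ^ (d * (ℓ - (q.z i).length)) * B := by
    refine Finset.sum_le_sum fun i _ => mul_le_mul_of_nonneg_left ?_ (by positivity)
    have := hT.2.1 _ (q.leaf i).1
    exact Vaux_le _ _ (by omega) (h i)
  rw [← Finset.sum_mul] at h1
  refine h1.trans (mul_le_mul_of_nonneg_right ?_ hB)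
  exact_mod_cast q.sum_volume_le hT

theorem le_pathCost {d ℓ : ℕ} {T : Set (List (Fin (2 ^ d)))} (hT : IsQuadtree d ℓ T)
    {s0 sg : List (Fin (2 ^ d))} (q : AbstractPath d ℓ T s0 sg) {c : List (Fin (2 ^ d)) → ℝ}
    (hc : ∀ x, x.length = ℓ → 0 ≤ c x) {i : Fin (q.R + 1)} {x : List (Fin (2 ^ d))}
    (hx : x.length = ℓ) (hi : q.z i <+: x) : c x ≤ pathCost d ℓ c q := by
  have hl : ∀ j, (q.z j).length + (ℓ - (q.z j).length) = ℓ := fun j =>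
    Nat.add_sub_of_le (hT.2.1 _ (q.leaf j).1)
  refine (le_pow_mul_Vaux hc hx _ _ (hl i) hi).trans ?_
  exact Finset.single_le_sum
    (f := fun j => (2 : ℝ) ^ (d * (ℓ - (q.z j).length)) * Vnode d ℓ c (q.z j))
    (fun j _ => mul_nonneg (by positivity) (Vaux_nonneg hc _ _ (hl j))) (Finset.mem_univ i)

/-- If `T1 ⊆ T2` are quadtrees and `T1` admits an ε-feasible abstract path, then every
minimal-cost abstract path in `T2` is ε-feasible. -/
theorem statement2
    (d ℓ : ℕ) (hd : 1 ≤ d) (hℓ : 1 ≤ ℓ)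
    (p : List (Fin (2 ^ d)) → ℝ)
    (hp : ∀ x : List (Fin (2 ^ d)), x.length = ℓ → 0 ≤ p x ∧ p x ≤ 1)
    (ε lam1 lam2 γ : ℝ)
    (hε0 : 0 ≤ ε) (hε1 : ε ≤ 1) (h10 : 0 < lam1) (h11 : lam1 ≤ 1)
    (h20 : 0 ≤ lam2) (h21 : lam2 ≤ 1) (hγ : 0 < γ)
    (s0 sg : List (Fin (2 ^ d))) (hs0 : s0.length = ℓ) (hsg : sg.length = ℓ)
    (T1 T2 : Set (List (Fin (2 ^ d))))
    (hT1 : IsQuadtree d ℓ T1) (hT2 : IsQuadtree d ℓ T2) (hsub : T1 ⊆ T2)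
    (hfeas : ∃ pth1 : AbstractPath d ℓ T1 s0 sg, EpsFeasible d ℓ p ε pth1)
    (pth2 : AbstractPath d ℓ T2 s0 sg)
    (hmin : ∀ q : AbstractPath d ℓ T2 s0 sg,
      pathCost d ℓ (cst d ℓ p ε lam1 lam2 γ) pth2 ≤
        pathCost d ℓ (cst d ℓ p ε lam1 lam2 γ) q) :
    EpsFeasible d ℓ p ε pth2 := by
  obtain ⟨π, hπ⟩ := hfeas
  obtain ⟨q, hq⟩ := exists_refined_abstractPath hT1 hT2 hsub hs0 hsg π
  have hB : 0 ≤ lam1 + ε * lam2 := by positivity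
  have hM : 0 ≤ Mval d ℓ ε lam1 lam2 γ := by unfold Mval; positivity
  have hc : ∀ x : List (Fin (2 ^ d)), x.length = ℓ → 0 ≤ cst d ℓ p ε lam1 lam2 γ x := by
    intro x hx
    have := (hp x hx).1
    unfold cst
    split_ifs
    · positivity
    · exact hM
  have hup : pathCost d ℓ (cst d ℓ p ε lam1 lam2 γ) q ≤ 2 ^ (d * ℓ) * (lam1 + ε * lam2) := by
    refine pathCost_le_of_bound hT2 q hB fun i x hx hxl => ?_
    obtain ⟨j, hj⟩ := hq i
    have hpx := hπ j x (hj.trans hx) hxl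
    rw [cst, if_pos hpx, mul_comm ε]
    gcongr
  intro i x hx hxl
  by_contra hpx
  have hlow := le_pathCost hT2 pth2 hc hxl hx
  rw [cst, if_neg hpx, Mval] at hlow
  linarith [hmin q]
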